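/- Assume r(s,a) ≤ 0 for all (s,a) and let e : ℝ → ℝ be non-decreasing. Then the unique bounded fixed point v^{*,e} of the operator T^e is non-decreasing in its second argument: for all s ∈ S and z₁ ≤ z₂, v^{*,e}(s,z₁) ≤ v^{*,e}(s,z₂). -/

import Mathlib

/-- The clamp `p(x) = max (−c) (min x c)`. -/
noncomputable def clampP (c : ℝ) (x : ℝ) : ℝ := max (-c) (min x c)

/-- The bounding operator `T^e`:
`T^e v (s, z) = max_{a ∈ A} [min 0 (r s a + z) - min 0 z
  + γ * Σ_{s'} P(s'|s,a) * v (s', p (e ((r s a + z) / γ)))]`,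
where `p` is the clamp to `[-rγ, rγ]`. `T^p` is the case `e = id`. -/
noncomputable def Te {S A : Type*} [Fintype S] [Fintype A] [Nonempty A]
    (P : S → A → PMF S) (r : S → A → ℝ) (γ rγ : ℝ) (e : ℝ → ℝ)
    (v : S × ℝ → ℝ) : S × ℝ → ℝ :=
  fun x => Finset.univ.sup' Finset.univ_nonempty fun a =>
    min 0 (r x.1 a + x.2) - min 0 x.2
      + γ * ∑ s' : S, ((P x.1 a) s').toReal *
          v (s', clampP rγ (e ((r x.1 a + x.2) / γ)))

theorem PMF.sum_toReal_eq_one {S : Type*} [Fintype S] (p : PMF S) :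
    ∑ s, (p s).toReal = 1 := by
  rw [← ENNReal.toReal_sum fun s _ => p.apply_ne_top s,
    ← tsum_fintype (L := .unconditional S), p.tsum_coe,
    ENNReal.toReal_one]

theorem clampP_monotone (c : ℝ) : Monotone (clampP c) := fun _ _ h =>
  max_le_max le_rfl (min_le_min h le_rfl)

theorem monotone_min_add_sub_min {r : ℝ} (hr : r ≤ 0) :
    Monotone fun z : ℝ => min 0 (r + z) - min 0 z := by
  intro z₁ z₂ h
  dsimp only
  grind

/-- If `v` fails to be monotone in its second argument by at most `C`, then `T^e v` fails by
at most `γ * C`. -/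
theorem Te_le_add_of_le_add {S A : Type*} [Fintype S] [Fintype A] [Nonempty A]
    (P : S → A → PMF S) {r : S → A → ℝ} {γ : ℝ} (rγ : ℝ) (hγ : 0 < γ)
    (hr : ∀ s a, r s a ≤ 0) {e : ℝ → ℝ} (he : Monotone e) {v : S × ℝ → ℝ} {C : ℝ}
    (hv : ∀ s z₁ z₂, z₁ ≤ z₂ → v (s, z₁) ≤ v (s, z₂) + C)
    (s : S) {z₁ z₂ : ℝ} (hz : z₁ ≤ z₂) :
    Te P r γ rγ e v (s, z₁) ≤ Te P r γ rγ e v (s, z₂) + γ * C := by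
  refine Finset.sup'_le _ _ fun a ha => ?_
  refine le_trans ?_ (add_le_add_left (Finset.le_sup' _ ha) (γ * C))
  dsimp only
  have harg : clampP rγ (e ((r s a + z₁) / γ)) ≤ clampP rγ (e ((r s a + z₂) / γ)) :=
    clampP_monotone rγ (he (by gcongr))
  have hsum : ∑ s', (P s a s').toReal * v (s', clampP rγ (e ((r s a + z₁) / γ))) ≤
      ∑ s', (P s a s').toReal * v (s', clampP rγ (e ((r s a + z₂) / γ))) + C := by
    calc _ ≤ ∑ s', (P s a s').toReal * (v (s', clampP rγ (e ((r s a + z₂) / γ))) + C) :=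
          Finset.sum_le_sum fun s' _ =>
            mul_le_mul_of_nonneg_left (hv s' _ _ harg) ENNReal.toReal_nonneg
      _ = _ := by
          simp only [mul_add, Finset.sum_add_distrib, ← Finset.sum_mul,
            PMF.sum_toReal_eq_one, one_mul]
  have hmin := monotone_min_add_sub_min (hr s a) hz
  dsimp only at hmin
  linarith [mul_le_mul_of_nonneg_left hsum hγ.le]

/-- with non-positive rewards and non-decreasing `e`, the unique bounded fixed
point of `T^e` is non-decreasing in its second argument. -/
theorem Te_fixedPoint_monotone
    {S A : Type*} [Fintype S] [Nonempty S] [Fintype A] [Nonempty A]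
    (P : S → A → PMF S) (r : S → A → ℝ) (r_max : ℝ) (hr_max : 0 < r_max)
    (hr : ∀ s a, |r s a| ≤ r_max) (γ : ℝ) (hγ : γ ∈ Set.Ioo (0 : ℝ) 1)
    (hr_nonpos : ∀ s a, r s a ≤ 0)
    (e : ℝ → ℝ) (he : Monotone e)
    (v : S × ℝ → ℝ) (hb : ∃ M : ℝ, ∀ s z, |v (s, z)| ≤ M)
    (hfix : Te P r γ (r_max / (1 - γ)) e v = v) :
    ∀ (s : S) (z₁ z₂ : ℝ), z₁ ≤ z₂ → v (s, z₁) ≤ v (s, z₂) := by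
  obtain ⟨M, hM⟩ := hb
  have hpow : ∀ (n : ℕ) (s : S) (z₁ z₂ : ℝ), z₁ ≤ z₂ →
      v (s, z₁) ≤ v (s, z₂) + γ ^ n * (2 * M) := by
    intro n
    induction n with
    | zero =>
      intro s z₁ z₂ _
      linarith [(abs_le.mp (hM s z₁)).2, (abs_le.mp (hM s z₂)).1]
    | succ n ih =>
      intro s z₁ z₂ hz
      have h := Te_le_add_of_le_add P (r_max / (1 - γ)) hγ.1 hr_nonpos he ih s hz
      rwa [hfix, ← mul_assoc, ← pow_succ'] at h
  intro s z₁ z₂ hz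
  have hlim : Filter.Tendsto (fun n : ℕ => v (s, z₂) + γ ^ n * (2 * M)) Filter.atTop
      (nhds (v (s, z₂))) := by
    simpa using ((tendsto_pow_atTop_nhds_zero_of_lt_one hγ.1.le hγ.2).mul_const
      (2 * M)).const_add (v (s, z₂))
  exact ge_of_tendsto' hlim fun n => hpow n s z₁ z₂ hz
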